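/- Let G be a tagged probabilistic context-free grammar with random symbols and Prior(E) := Expand(E)(S). For any two expressions E, E' ∈ 𝓛(G) and parse-tree node a with Sever(E)(a) = Sever(E')(a) = (N_i, E_hole), one has Prior(E') = Prior(E) · Expand(Subexpr(E')(a))(N_i) / Expand(Subexpr(E)(a))(N_i). -/

import Mathlib

/-- S-expressions over phrase tags `τ` and terminal symbols `ς`, together with the
hole symbol `□`: `(T_{ik} s)` is `leaf T_{ik} s`, `(T_{ik} E₁ … E_h)` is
`node T_{ik} [E₁,…,E_h]`, and `□` is `hole`. -/
inductive SExpr (τ ς : Type) : Type where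
  | hole : SExpr τ ς
  | leaf : τ → ς → SExpr τ ς
  | node : τ → List (SExpr τ ς) → SExpr τ ς

/-- A tagged probabilistic context-free grammar with random symbols
`G = (Σ, N, R, T, P, Q, S)`: terminals `ς`, nonterminals `ν`, and production rules indexed
by their unique phrase tags `τ`; the rule with tag `t` has left-hand side nonterminal
`lhs t` and right-hand side nonterminals `rhs t` (empty list = non-recursive rule);
`P : T → (0,1]` with the probabilities of the rules of each nonterminal summing to one;
`Q : T × Σ → [0,1]` with `∑_s Q(t,s) = 1` for each tag; start symbol `start`. -/
structure TPCFG (τ ς ν : Type) [Fintype τ] [Fintype ς] [Fintype ν]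
    [DecidableEq τ] [DecidableEq ς] [DecidableEq ν] where
  lhs : τ → ν
  rhs : τ → List ν
  P : τ → ℝ
  Q : τ → ς → ℝ
  start : ν
  P_pos : ∀ t, 0 < P t
  P_le : ∀ t, P t ≤ 1
  P_sum : ∀ n : ν, ∑ t ∈ Finset.univ.filter (fun t => lhs t = n), P t = 1
  Q_nonneg : ∀ t s, 0 ≤ Q t s
  Q_sum : ∀ t, ∑ s : ς, Q t s = 1

variable {τ ς ν : Type} [Fintype τ] [Fintype ς] [Fintype ν]
  [DecidableEq τ] [DecidableEq ς] [DecidableEq ν]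

mutual
/-- The semantic function `Expand`:
`Expand((t s))(n) = P(t)·Q(t,s)` if `t` is (the tag of) a non-recursive rule of `n`;
`Expand((t E₁…E_h))(n) = P(t)·∏_z Expand(E_z)(Ñ_z)` if `t` is a recursive rule of `n`
with right-hand side nonterminals `Ñ_1…Ñ_h`; `Expand(E)(n) = 0` when the head tag of `E`
is not a tag of a rule of `n`; and `Expand(□)(n) = 1` for the hole. -/
noncomputable def expand (G : TPCFG τ ς ν) : SExpr τ ς → ν → ℝ
  | .hole, _ => 1
  | .leaf t s, n => if G.lhs t = n ∧ G.rhs t = [] then G.P t * G.Q t s else 0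
  | .node t es, n =>
      if G.lhs t = n ∧ G.rhs t ≠ [] then G.P t * expandList G es (G.rhs t) else 0
noncomputable def expandList (G : TPCFG τ ς ν) : List (SExpr τ ς) → List ν → ℝ
  | [], [] => 1
  | e :: es, m :: ms => expand G e m * expandList G es ms
  | _, _ => 0
end

mutual
/-- `Subexpr(E)(a)`: the subexpression of `E` at parse-tree node `a` (a list of
(0-indexed) subexpression positions), if it exists. -/
def subexpr : SExpr τ ς → List ℕ → Option (SExpr τ ς)
  | e, [] => some e
  | .node _ es, j :: a => subexprList es j a
  | _, _ :: _ => none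
def subexprList : List (SExpr τ ς) → ℕ → List ℕ → Option (SExpr τ ς)
  | [], _, _ => none
  | e :: _, 0, a => subexpr e a
  | _ :: es, j + 1, a => subexprList es j a
end

mutual
/-- Replace the subexpression of `E` at parse-tree node `a` by `r`, if the node exists. -/
def replaceAt : SExpr τ ς → List ℕ → SExpr τ ς → Option (SExpr τ ς)
  | _, [], r => some r
  | .node t es, j :: a, r => (replaceAtList es j a r).map (.node t ·)
  | _, _ :: _, _ => none
def replaceAtList : List (SExpr τ ς) → ℕ → List ℕ → SExpr τ ς → Option (List (SExpr τ ς))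
  | [], _, _, _ => none
  | e :: es, 0, a, r => (replaceAt e a r).map (· :: es)
  | e :: es, j + 1, a, r => (replaceAtList es j a r).map (e :: ·)
end

/-- The head phrase tag of an s-expression. -/
def headTag : SExpr τ ς → Option τ
  | .hole => none
  | .leaf t _ => some t
  | .node t _ => some t

/-- `Sever(E)(a) = (N_i, E_hole)`: `E_hole` is `E` with the subexpression at parse-tree
node `a` replaced by the hole `□`, and `N_i` is the nonterminal from whose production rule
the head tag of the removed subexpression arises (i.e. the left-hand side of that rule);
returns `none` (failure `∅`) if `E` has no node `a`. -/
def sever (G : TPCFG τ ς ν) (E : SExpr τ ς) (a : List ℕ) : Option (ν × SExpr τ ς) :=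
  match subexpr E a, replaceAt E a .hole with
  | some e, some Ehole =>
      match headTag e with
      | some t => some (G.lhs t, Ehole)
      | none => none
  | _, _ => none

mutual
/-- `A_E`: the finite set of parse-tree nodes of an expression `E`. -/
def nodes : SExpr τ ς → Finset (List ℕ)
  | .hole => {[]}
  | .leaf _ _ => {[]}
  | .node _ es => insert [] (nodesList 0 es)
def nodesList : ℕ → List (SExpr τ ς) → Finset (List ℕ)
  | _, [] => ∅
  | j, e :: es => (nodes e).image (j :: ·) ∪ nodesList (j + 1) es
end

theorem expand_ne_zero_lhs (G : TPCFG τ ς ν) (e : SExpr τ ς) (n : ν) (t : τ)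
    (h : expand G e n ≠ 0) (ht : headTag e = some t) : G.lhs t = n := by
  cases e with
  | hole => simp [headTag] at ht
  | leaf u s =>
    simp only [headTag, Option.some.injEq] at ht
    subst ht
    simp only [expand] at h
    by_contra hc
    simp [hc] at h
  | node u es =>
    simp only [headTag, Option.some.injEq] at ht
    subst ht
    simp only [expand] at h
    by_contra hc
    simp [hc] at h

theorem expand_factor (G : TPCFG τ ς ν) (e : SExpr τ ς) (t : τ) (ht : headTag e = some t)
    (a : List ℕ) : ∀ (E H : SExpr τ ς) (n : ν), expand G E n ≠ 0 →
      subexpr E a = some e → replaceAt E a .hole = some H →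
      expand G E n = expand G H n * expand G e (G.lhs t) := by
  induction a with
  | nil =>
    intro E H n h hs hr
    simp only [subexpr, replaceAt, Option.some.injEq] at hs hr
    subst hs hr
    rw [expand_ne_zero_lhs G _ n t h ht]
    simp [expand]
  | cons j a ih =>
    have key : ∀ (es : List (SExpr τ ς)) (j : ℕ) (hs : List (SExpr τ ς)) (ms : List ν),
        expandList G es ms ≠ 0 → subexprList es j a = some e →
        replaceAtList es j a .hole = some hs →
        expandList G es ms = expandList G hs ms * expand G e (G.lhs t) := by
      intro es
      induction es with
      | nil => intro j hs ms _ h; simp [subexprList] at h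
      | cons x xs ihx =>
        intro j hs ms h0 h1 h2
        cases ms with
        | nil => simp [expandList] at h0
        | cons m ms =>
          simp only [expandList, ne_eq, mul_eq_zero, not_or] at h0
          cases j with
          | zero =>
            simp only [subexprList, replaceAtList, Option.map_eq_some_iff] at h1 h2
            obtain ⟨y, hy, rfl⟩ := h2
            simp only [expandList]
            rw [ih x y m h0.1 h1 hy]
            ring
          | succ j =>
            simp only [subexprList, replaceAtList, Option.map_eq_some_iff] at h1 h2
            obtain ⟨y, hy, rfl⟩ := h2
            simp only [expandList]
            rw [ihx j y ms h0.2 h1 hy]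
            ring
    intro E H n h hs hr
    cases E with
    | hole => simp [subexpr] at hs
    | leaf u s => simp [subexpr] at hs
    | node u es =>
      simp only [subexpr, replaceAt, Option.map_eq_some_iff] at hs hr
      obtain ⟨y, hy, rfl⟩ := hr
      simp only [expand] at h ⊢
      split_ifs at h ⊢ with hc
      · rw [key es j y _ (right_ne_zero_of_mul h) hs hy]
        ring
      · exact absurd rfl h

theorem expand_of_sever (G : TPCFG τ ς ν) (E : SExpr τ ς) (n : ν) (h : expand G E n ≠ 0)
    (a : List ℕ) (Ni : ν) (H e : SExpr τ ς) (hsev : sever G E a = some (Ni, H))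
    (hsub : subexpr E a = some e) : expand G E n = expand G H n * expand G e Ni := by
  unfold sever at hsev
  rw [hsub] at hsev
  cases hr : replaceAt E a .hole with
  | none => simp [hr] at hsev
  | some H' =>
    cases ht : headTag e with
    | none => simp [hr, ht] at hsev
    | some t =>
      simp only [hr, ht, Option.some.injEq, Prod.mk.injEq] at hsev
      obtain ⟨rfl, rfl⟩ := hsev
      exact expand_factor G e t ht a E _ n h hsub hr

/-- Let `G` be a tagged PCFG with random symbols and
`Prior(E) := Expand(E)(S)`.  For any two expressions `E, E' ∈ 𝓛(G)` and parse-tree node `a`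
with `Sever(E)(a) = Sever(E')(a) = (N_i, E_hole)`, one has
`Prior(E') = Prior(E) · Expand(Subexpr(E')(a))(N_i) / Expand(Subexpr(E)(a))(N_i)`. -/
theorem prior_ratio_of_sever_eq (G : TPCFG τ ς ν) (E E' : SExpr τ ς)
    (hE : 0 < expand G E G.start) (hE' : 0 < expand G E' G.start)
    (a : List ℕ) (ha : a ∈ nodes E) (ha' : a ∈ nodes E')
    (Ni : ν) (Ehole : SExpr τ ς)
    (hsev : sever G E a = some (Ni, Ehole)) (hsev' : sever G E' a = some (Ni, Ehole))
    (Esub Esub' : SExpr τ ς)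
    (hsub : subexpr E a = some Esub) (hsub' : subexpr E' a = some Esub') :
    expand G E' G.start = expand G E G.start * expand G Esub' Ni / expand G Esub Ni := by
  have h1 := expand_of_sever G E _ hE.ne' a Ni Ehole Esub hsev hsub
  have h2 := expand_of_sever G E' _ hE'.ne' a Ni Ehole Esub' hsev' hsub'
  have h3 : expand G Esub Ni ≠ 0 := by
    intro h0
    rw [h0, mul_zero] at h1
    exact hE.ne' h1
  rw [h2, h1]
  field_simp
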